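/- For every line l ∈ L, the vector d_l = √3·e_l + Σ_{p ⊆ l} e_p satisfies ⟨d_l, e_q⟩ = 0 for every point q ∈ P and ⟨d_l, e_m⟩ = −√3 for every line m ∈ L. Consequently d_l − d_m lies in the radical of the bilinear form for any two lines l, m. -/

import Mathlib

open scoped Classical

namespace AllcockStmt14

noncomputable section

/-- The points of the projective plane `ℙ²(𝔽₃)`. -/
abbrev Pt := {W : Submodule (ZMod 3) (Fin 3 → ZMod 3) // Module.finrank (ZMod 3) W = 1}

/-- The lines of the projective plane `ℙ²(𝔽₃)`. -/
abbrev Ln := {W : Submodule (ZMod 3) (Fin 3 → ZMod 3) // Module.finrank (ZMod 3) W = 2}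

/-- The real symmetric `26 × 26` matrix `M` indexed by `P ⊔ L`: diagonal
entries `3`, entries `-√3` for every incident pair, all other entries `0`. -/
def M : Matrix (Pt ⊕ Ln) (Pt ⊕ Ln) ℝ := fun u v =>
  match u, v with
  | Sum.inl p, Sum.inl q => if p = q then 3 else 0
  | Sum.inl p, Sum.inr l => if p.1 ≤ l.1 then -Real.sqrt 3 else 0
  | Sum.inr l, Sum.inl p => if p.1 ≤ l.1 then -Real.sqrt 3 else 0
  | Sum.inr l, Sum.inr m => if l = m then 3 else 0

/-- The symmetric bilinear form `⟨u, v⟩ = Σ_{i,j} u_i · M_{ij} · v_j` on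
`ℝ^(P ⊔ L)`. -/
def B (u v : (Pt ⊕ Ln) → ℝ) : ℝ :=
  ∑ i, ∑ j, u i * M i j * v j

/-- The standard basis vector `e_i` of `ℝ^(P ⊔ L)`. -/
def e (i : Pt ⊕ Ln) : (Pt ⊕ Ln) → ℝ := Pi.single i 1

/-- `d_l = √3·e_l + Σ_{p ⊆ l} e_p`. -/
def d (l : Ln) : (Pt ⊕ Ln) → ℝ :=
  Real.sqrt 3 • e (Sum.inr l) +
    ∑ p ∈ Finset.univ.filter (fun p : Pt => p.1 ≤ l.1), e (Sum.inl p)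

lemma card_points_le_line (l : Ln) :
    (Finset.univ.filter (fun p : Pt => p.1 ≤ l.1)).card = 4 := by
  have h := Projectivization.card_of_finrank_two (ZMod 3) l.1 l.2
  rw [Nat.card_zmod, Nat.card_congr (Projectivization.equivSubmodule (ZMod 3) l.1)] at h
  rw [← Fintype.card_subtype, ← Nat.card_eq_fintype_card]
  refine Eq.trans (Nat.card_congr ?_) h
  exact
    { toFun := fun p => ⟨p.1.1.submoduleOf l.1,
        ((Submodule.submoduleOfEquivOfLe p.2).finrank_eq).trans p.1.2⟩
      invFun := fun H => ⟨⟨H.1.map l.1.subtype,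
        (Submodule.finrank_map_subtype_eq l.1 H.1).trans H.2⟩, Submodule.map_subtype_le l.1 H.1⟩
      left_inv := fun p => by
        ext1; ext1
        exact (Submodule.map_comap_subtype l.1 p.1.1).trans (inf_eq_right.2 p.2)
      right_inv := fun H => by
        ext1
        exact Submodule.comap_map_eq_of_injective l.1.injective_subtype H.1 }

lemma finrank_inf_of_ne {l m : Ln} (h : l ≠ m) :
    Module.finrank (ZMod 3) (l.1 ⊓ m.1 : Submodule (ZMod 3) (Fin 3 → ZMod 3)) = 1 := by
  have hsum := Submodule.finrank_sup_add_finrank_inf_eq l.1 m.1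
  have hle := Submodule.finrank_le (l.1 ⊔ m.1)
  rw [l.2, m.2] at hsum
  rw [Module.finrank_fin_fun] at hle
  have hlt : l.1 < l.1 ⊔ m.1 := by
    refine lt_of_le_of_ne le_sup_left fun heq => h (Subtype.ext ?_)
    exact (Submodule.eq_of_le_of_finrank_eq (sup_eq_left.1 heq.symm) (m.2.trans l.2.symm)).symm
  have := Submodule.finrank_lt_finrank_of_lt hlt
  rw [l.2] at this
  omega

lemma card_common_points (l m : Ln) :
    (Finset.univ.filter (fun p : Pt => p.1 ≤ l.1 ∧ p.1 ≤ m.1)).card = if l = m then 4 else 1 := by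
  split_ifs with h
  · subst h
    simpa only [and_self] using card_points_le_line l
  · have hr := finrank_inf_of_ne h
    rw [Finset.card_eq_one]
    refine ⟨⟨l.1 ⊓ m.1, hr⟩, ?_⟩
    ext p
    simp only [Finset.mem_filter, Finset.mem_univ, true_and, Finset.mem_singleton, ← le_inf_iff]
    constructor
    · intro hp
      exact Subtype.ext (Submodule.eq_of_le_of_finrank_eq hp (p.2.trans hr.symm))
    · rintro rfl
      exact le_rfl

lemma B_eq_sum_basis (u v : (Pt ⊕ Ln) → ℝ) : B u v = ∑ j, B u (e j) * v j := by
  simp only [B, e, Pi.single_apply, mul_ite, mul_one, mul_zero, Finset.sum_ite_eq',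
    Finset.mem_univ, if_true, Finset.sum_mul]
  exact Finset.sum_comm

lemma B_sub_left (u u' v : (Pt ⊕ Ln) → ℝ) : B (u - u') v = B u v - B u' v := by
  simp only [B, Pi.sub_apply, sub_mul, Finset.sum_sub_distrib]

lemma d_inl (l : Ln) (p : Pt) : d l (Sum.inl p) = if p.1 ≤ l.1 then 1 else 0 := by
  simp [d, e, Finset.sum_apply, Pi.single_apply]

lemma d_inr (l m : Ln) : d l (Sum.inr m) = if m = l then Real.sqrt 3 else 0 := by
  simp [d, e, Finset.sum_apply, Pi.single_apply]

lemma B_d_e (l : Ln) (j : Pt ⊕ Ln) :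
    B (d l) (e j) = (∑ p : Pt, if p.1 ≤ l.1 then M (Sum.inl p) j else 0) +
      Real.sqrt 3 * M (Sum.inr l) j := by
  simp only [B, e, Pi.single_apply, mul_ite, mul_one, mul_zero, Finset.sum_ite_eq',
    Finset.mem_univ, if_true, Fintype.sum_sum_type, d_inl, d_inr, ite_mul,
    one_mul, zero_mul]

lemma B_d_point (l : Ln) (q : Pt) : B (d l) (e (Sum.inl q)) = 0 := by
  have h3 : Real.sqrt 3 * Real.sqrt 3 = 3 := Real.mul_self_sqrt (by norm_num)
  rw [B_d_e, Finset.sum_eq_single q]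
  · by_cases h : q.1 ≤ l.1 <;> simp [M, h, h3]
  · intro p _ hp
    simp [M, hp]
  · simp

lemma B_d_line (l m : Ln) : B (d l) (e (Sum.inr m)) = -Real.sqrt 3 := by
  rw [B_d_e]
  simp only [M, ← ite_and]
  rw [← Finset.sum_filter, Finset.sum_const, card_common_points]
  split_ifs
  · simp only [nsmul_eq_mul]
    push_cast
    ring
  · simp

/-- For every line `l`, the vector `d_l` satisfies
`⟨d_l, e_q⟩ = 0` for every point `q` and `⟨d_l, e_m⟩ = -√3` for every line `m`.
Consequently `d_l - d_m` lies in the radical of the bilinear form for any two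
lines `l, m`. -/
theorem d_pairings_and_radical :
    (∀ l : Ln,
      (∀ q : Pt, B (d l) (e (Sum.inl q)) = 0) ∧
      (∀ m : Ln, B (d l) (e (Sum.inr m)) = -Real.sqrt 3)) ∧
    (∀ l m : Ln, ∀ v : (Pt ⊕ Ln) → ℝ, B (d l - d m) v = 0) := by
  refine ⟨fun l => ⟨B_d_point l, B_d_line l⟩, fun l m v => ?_⟩
  rw [B_eq_sum_basis]
  refine Finset.sum_eq_zero fun j _ => ?_
  rw [B_sub_left]
  cases j with
  | inl q => rw [B_d_point, B_d_point, sub_self, zero_mul]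
  | inr k => rw [B_d_line, B_d_line, sub_self, zero_mul]

end

end AllcockStmt14
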